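/- For every integer r ≥ 3 and every integer m ≥ 2r² + 2r, let ℱ_m = {B_{m,m}, V_{m,r}, Λ_{m,r}}, where B_{m,m} is the disjoint union of two copies of K_m plus one edge joining them, V_{m,r} is the union of a copy of K_m and a copy of K_{m-r+1} overlapping in exactly one common vertex, and Λ_{m,r} is a copy of K_m plus a single new vertex with exactly r edges to the K_m. Then the sequence sat(n, K_r, ℱ_m)/n does not converge as n → ∞. -/

import Mathlib

open SimpleGraph Finset

variable {V : Type*}

/-- The graph `G` with the edge `u v` added. -/
def addEdge (G : SimpleGraph V) (u v : V) : SimpleGraph V :=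
  G ⊔ SimpleGraph.fromEdgeSet {s(u, v)}

/-- `G` is `K_s`-saturated: `G` is `K_s`-free and adding any missing edge creates a `K_s`. -/
def KSat (s : ℕ) (G : SimpleGraph V) : Prop :=
  G.CliqueFree s ∧ ∀ u v : V, u ≠ v → ¬ G.Adj u v → ¬ (addEdge G u v).CliqueFree s

/-- The number of copies of `K_r` in `G`: the number of `r`-sets of vertices inducing
a complete graph. -/
noncomputable def cliqueCount (G : SimpleGraph V) (r : ℕ) : ℕ :=
  {t : Finset V | G.IsNClique r t}.ncard

/-- `sat(n, K_r, K_s)`: minimum number of copies of `K_r` in an `n`-vertex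
`K_s`-saturated graph. -/
noncomputable def satCliques (n r s : ℕ) : ℕ :=
  sInf {m | ∃ G : SimpleGraph (Fin n), KSat s G ∧ cliqueCount G r = m}

/-- The join `K_{s-2} ∗ ∅_{n-s+2}` on `Fin n`. -/
def joinGraph (n s : ℕ) : SimpleGraph (Fin n) :=
  SimpleGraph.fromRel (fun i _ => (i : ℕ) < s - 2)

/-- The number of copies of `C_r` in `G` : the number of subgraphs of `G`
isomorphic to the cycle on `r` vertices. -/
noncomputable def cycleCount (G : SimpleGraph V) (r : ℕ) : ℕ :=
  {H : G.Subgraph | Nonempty (H.coe ≃g cycleGraph r)}.ncard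

/-- `sat(n, C_r, K_s)`. -/
noncomputable def satCyclesCliqueSat (n r s : ℕ) : ℕ :=
  sInf {m | ∃ G : SimpleGraph (Fin n), KSat s G ∧ cycleCount G r = m}

/-- `G` contains a copy of `F`, i.e. a subgraph isomorphic to `F`. -/
def ContainsCopy {α β : Type*} (F : SimpleGraph α) (G : SimpleGraph β) : Prop :=
  ∃ f : α → β, Function.Injective f ∧ ∀ a b : α, F.Adj a b → G.Adj (f a) (f b)

/-- strongly K_s-saturated -/
def StronglyKSat (s : ℕ) (G : SimpleGraph V) : Prop :=
  ∀ u v : V, u ≠ v → ¬ G.Adj u v →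
    ∃ t : Finset V, (addEdge G u v).IsNClique s t ∧ u ∈ t ∧ v ∈ t

/-- dumbbell -/
def dumbbell (m : ℕ) : SimpleGraph (Fin (2 * m)) :=
  SimpleGraph.fromRel (fun i j =>
    ((i : ℕ) < m ∧ (j : ℕ) < m) ∨ (m ≤ (i : ℕ) ∧ m ≤ (j : ℕ)) ∨ ((i : ℕ) = 0 ∧ (j : ℕ) = m))

def Vgraph (m : ℕ) : SimpleGraph (Fin (m + 2)) :=
  SimpleGraph.fromRel (fun i j =>
    ((i : ℕ) < m ∧ (j : ℕ) < m) ∨ ((i : ℕ) = 0 ∧ m ≤ (j : ℕ)))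

def lambdaGraph (m : ℕ) : SimpleGraph (Fin (m + 1)) :=
  SimpleGraph.fromRel (fun i j =>
    ((i : ℕ) < m ∧ (j : ℕ) < m) ∨ ((i : ℕ) = m ∧ (j : ℕ) < 2))

def VgraphGen (m r : ℕ) : SimpleGraph (Fin (m + (m - r))) :=
  SimpleGraph.fromRel (fun i j =>
    ((i : ℕ) < m ∧ (j : ℕ) < m) ∨
      (((i : ℕ) = 0 ∨ m ≤ (i : ℕ)) ∧ ((j : ℕ) = 0 ∨ m ≤ (j : ℕ))))

def lambdaGraphGen (m r : ℕ) : SimpleGraph (Fin (m + 1)) :=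
  SimpleGraph.fromRel (fun i j =>
    ((i : ℕ) < m ∧ (j : ℕ) < m) ∨ ((i : ℕ) = m ∧ (j : ℕ) < r))

/-- `G` is saturated with respect to the family `{F₁, F₂, F₃}`. -/
def FamSat3 {α₁ α₂ α₃ : Type*} (F₁ : SimpleGraph α₁) (F₂ : SimpleGraph α₂)
    (F₃ : SimpleGraph α₃) (G : SimpleGraph V) : Prop :=
  ¬ ContainsCopy F₁ G ∧ ¬ ContainsCopy F₂ G ∧ ¬ ContainsCopy F₃ G ∧
    ∀ u v : V, u ≠ v → ¬ G.Adj u v →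
      ContainsCopy F₁ (addEdge G u v) ∨ ContainsCopy F₂ (addEdge G u v) ∨
        ContainsCopy F₃ (addEdge G u v)

noncomputable def satFam3 {α₁ α₂ α₃ : Type*} (n : ℕ) (F₁ : SimpleGraph α₁)
    (F₂ : SimpleGraph α₂) (F₃ : SimpleGraph α₃) : ℕ :=
  sInf {m | ∃ G : SimpleGraph (Fin n), FamSat3 F₁ F₂ F₃ G ∧ G.edgeSet.ncard = m}

noncomputable def satCliquesFam3 {α₁ α₂ α₃ : Type*} (n r : ℕ) (F₁ : SimpleGraph α₁)
    (F₂ : SimpleGraph α₂) (F₃ : SimpleGraph α₃) : ℕ :=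
  sInf {m | ∃ G : SimpleGraph (Fin n), FamSat3 F₁ F₂ F₃ G ∧ cliqueCount G r = m}

/-- saturation w.r.t. a single graph, with copies as subgraphs. -/
def SatGraph {α : Type*} (F : SimpleGraph α) (G : SimpleGraph V) : Prop :=
  ¬ ContainsCopy F G ∧ ∀ u v : V, u ≠ v → ¬ G.Adj u v → ContainsCopy F (addEdge G u v)

noncomputable def satCyclesGraphSat {α : Type*} (n r : ℕ) (F : SimpleGraph α) : ℕ :=
  sInf {m | ∃ G : SimpleGraph (Fin n), SatGraph F G ∧ cycleCount G r = m}

/-- number of independent sets of size l -/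
noncomputable def indepCount (G : SimpleGraph V) (l : ℕ) : ℕ :=
  {t : Finset V | t.card = l ∧ ∀ a ∈ t, ∀ b ∈ t, ¬ G.Adj a b}.ncard

/-- Ramsey number -/
noncomputable def ramsey (l s : ℕ) : ℕ :=
  sInf {N | ∀ G : SimpleGraph (Fin N),
    (∃ t : Finset (Fin N), t.card = l ∧ ∀ a ∈ t, ∀ b ∈ t, ¬ G.Adj a b) ∨
      ∃ t : Finset (Fin N), G.IsNClique s t}

section Copies

variable {m r : ℕ} {G : SimpleGraph V} {S S' T : Finset V} {u v x y : V}

theorem addEdge_adj (G : SimpleGraph V) (u v a b : V) :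
    (addEdge G u v).Adj a b ↔ G.Adj a b ∨ (a = u ∧ b = v ∨ a = v ∧ b = u) ∧ a ≠ b := by
  simp [addEdge]

theorem containsCopy_fromRel {α β : Type*} {R : α → α → Prop} {G : SimpleGraph β} (f : α → β)
    (hf : Function.Injective f) (h : ∀ a b, a ≠ b → R a b → G.Adj (f a) (f b)) :
    ContainsCopy (SimpleGraph.fromRel R) G := by
  refine ⟨f, hf, fun a b hab => ?_⟩
  rw [SimpleGraph.fromRel_adj] at hab
  obtain ⟨hne, h1 | h1⟩ := hab
  · exact h a b hne h1
  · exact (h b a hne.symm h1).symm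

/-- A finite set can be enumerated by an initial segment of `ℕ`, starting with any given subset. -/
theorem exists_enumeration [Nonempty V] [DecidableEq V] (h : T ⊆ S) :
    ∃ g : ℕ → V, (∀ i < #T, g i ∈ T) ∧ (∀ i < #S, g i ∈ S) ∧
      ∀ i < #S, ∀ j < #S, g i = g j → i = j := by
  obtain ⟨d⟩ := ‹Nonempty V›
  set l := T.toList ++ (S \ T).toList with hl
  have hlen : l.length = #S := by
    simp [hl, card_sdiff_of_subset h, Nat.add_sub_cancel' (card_le_card h)]
  have hnodup : l.Nodup := by
    rw [hl, List.nodup_append']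
    refine ⟨nodup_toList _, nodup_toList _, fun a ha hb => ?_⟩
    simp at ha hb
    exact hb.2 ha
  refine ⟨fun i => l.getD i d, fun i hi => ?_, fun i hi => ?_, fun i hi j hj hij => ?_⟩
  · have : i < T.toList.length := by simpa using hi
    simp only [hl, List.getD_append _ _ _ _ this, List.getD_eq_getElem _ _ this]
    exact mem_toList.1 (List.getElem_mem this)
  · have : i < l.length := hlen ▸ hi
    simp only [List.getD_eq_getElem _ _ this]
    have := List.getElem_mem this
    simp only [hl, List.mem_append, mem_toList, mem_sdiff] at this
    exact this.elim (fun h' => h h') And.left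
  · have h1 : i < l.length := hlen ▸ hi
    have h2 : j < l.length := hlen ▸ hj
    simp only [List.getD_eq_getElem _ _ h1, List.getD_eq_getElem _ _ h2] at hij
    exact (hnodup.getElem_inj_iff).1 hij

theorem containsCopy_lambdaGraphGen [DecidableEq V] (hS : G.IsNClique m S) (hx : x ∉ S)
    (hT : T ⊆ S) (hTr : #T = r) (hadj : ∀ y ∈ T, G.Adj x y) :
    ContainsCopy (lambdaGraphGen m r) G := by
  have : Nonempty V := ⟨x⟩
  obtain ⟨g, hgT, hgS, hg⟩ := exists_enumeration hT
  rw [hTr] at hgT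
  rw [hS.card_eq] at hgS hg
  refine containsCopy_fromRel (fun i => if (i : ℕ) < m then g i else x) (fun i j hij => ?_)
    (fun i j hne h => ?_)
  · have := hgS i
    have := hgS j
    ext
    grind
  · have hr : r ≤ m := by rw [← hTr, ← hS.card_eq]; exact card_le_card hT
    rcases h with ⟨hi, hj⟩ | ⟨hi, hj⟩
    · simp only [hi, hj, if_true]
      exact hS.isClique (hgS _ hi) (hgS _ hj) fun h => hne (Fin.ext (hg _ hi _ hj h))
    · simp only [hi, lt_irrefl, if_false, hj.trans_le hr, if_true]
      exact hadj _ (hgT _ hj)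

theorem containsCopy_VgraphGen [DecidableEq V] (hS : G.IsNClique m S) (hx : x ∈ S)
    (hS' : G.IsClique (insert x S' : Set V)) (hS'r : #S' = m - r) (hdisj : Disjoint S S') :
    ContainsCopy (VgraphGen m r) G := by
  have : Nonempty V := ⟨x⟩
  obtain ⟨g, hgT, hgS, hg⟩ := exists_enumeration (singleton_subset_iff.2 hx)
  obtain ⟨g', -, hgS', hg'⟩ := exists_enumeration (empty_subset S')
  rw [hS.card_eq] at hgS hg
  rw [hS'r] at hgS' hg'
  have hg0 : g 0 = x := by simpa using hgT 0 (by simp)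
  have hm : 0 < m := by rw [← hS.card_eq]; exact card_pos.2 ⟨x, hx⟩
  have hne' : ∀ i < m, ∀ j < m - r, g i ≠ g' j := fun i hi j hj h =>
    disjoint_left.1 hdisj (hgS i hi) (h ▸ hgS' j hj)
  have hinj : Function.Injective
      (fun i : Fin (m + (m - r)) => if (i : ℕ) < m then g i else g' (i - m)) := by
    intro i j hij
    have := i.2
    have := j.2
    ext
    grind
  refine containsCopy_fromRel _ hinj (fun i j hne h => ?_)
  have hne := hinj.ne hne
  rcases h with ⟨hi, hj⟩ | h
  · simp only [hi, hj, if_true] at hne ⊢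
    exact hS.isClique (hgS _ hi) (hgS _ hj) hne
  · have key : ∀ i : Fin (m + (m - r)), ((i : ℕ) = 0 ∨ m ≤ (i : ℕ)) →
        (if (i : ℕ) < m then g i else g' (i - m)) ∈ (insert x S' : Set V) := by
      intro i hi
      rcases hi with hi | hi
      · simp [hi, hm, hg0]
      · rw [if_neg (by omega)]
        exact Set.mem_insert_of_mem _ (hgS' _ (by omega))
    exact hS' (key i h.1) (key j h.2) hne

theorem containsCopy_dumbbell [DecidableEq V] (hS : G.IsNClique m S) (hS' : G.IsNClique m S')
    (hdisj : Disjoint S S') (hx : x ∈ S) (hy : y ∈ S') (hxy : G.Adj x y) :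
    ContainsCopy (dumbbell m) G := by
  have : Nonempty V := ⟨x⟩
  obtain ⟨g, hgT, hgS, hg⟩ := exists_enumeration (singleton_subset_iff.2 hx)
  obtain ⟨g', hgT', hgS', hg'⟩ := exists_enumeration (singleton_subset_iff.2 hy)
  rw [hS.card_eq] at hgS hg
  rw [hS'.card_eq] at hgS' hg'
  have hg0 : g 0 = x := by simpa using hgT 0 (by simp)
  have hg0' : g' 0 = y := by simpa using hgT' 0 (by simp)
  have hm : 0 < m := by rw [← hS.card_eq]; exact card_pos.2 ⟨x, hx⟩
  have hne' : ∀ i < m, ∀ j < m, g i ≠ g' j := fun i hi j hj h =>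
    disjoint_left.1 hdisj (hgS i hi) (h ▸ hgS' j hj)
  have hinj : Function.Injective
      (fun i : Fin (2 * m) => if (i : ℕ) < m then g i else g' (i - m)) := by
    intro i j hij
    have := i.2
    have := j.2
    ext
    grind
  refine containsCopy_fromRel _ hinj (fun i j hne h => ?_)
  have hne := hinj.ne hne
  rcases h with ⟨hi, hj⟩ | ⟨hi, hj⟩ | ⟨hi, hj⟩
  · simp only [hi, hj, if_true] at hne ⊢
    exact hS.isClique (hgS _ hi) (hgS _ hj) hne
  · simp only [hi.not_gt, hj.not_gt, if_false] at hne ⊢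
    exact hS'.isClique (hgS' _ (by omega)) (hgS' _ (by omega)) hne
  · simpa [hi, hj, hm, hg0, hg0'] using hxy

end Copies

section Structure

variable {m r k : ℕ} {G : SimpleGraph V} {S S' : Finset V} {u v x y : V}

theorem isClique_or_exists_of_isClique_addEdge [DecidableEq V]
    (hS : (addEdge G u v).IsClique (S : Set V)) (hk : k + 2 ≤ #S) :
    G.IsClique (S : Set V) ∨ ∃ C, G.IsNClique k C ∧ ∀ w ∈ C, G.Adj u w ∧ G.Adj v w := by
  by_cases huv : u ∈ S ∧ v ∈ S
  · right
    have hcard : k ≤ #((S.erase u).erase v) := by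
      have h1 := pred_card_le_card_erase (s := S) (a := u)
      have h2 := pred_card_le_card_erase (s := S.erase u) (a := v)
      omega
    obtain ⟨C, hC, hCk⟩ := exists_subset_card_eq hcard
    have hmem : ∀ w ∈ C, w ∈ S ∧ w ≠ u ∧ w ≠ v := by
      intro w hw
      have := hC hw
      simp only [mem_erase] at this
      tauto
    have hG : ∀ a ∈ S, ∀ w ∈ C, a ≠ w → G.Adj a w := by
      intro a ha w hw haw
      have := hS ha (hmem w hw).1 haw
      rw [addEdge_adj] at this
      grind
    exact ⟨C, ⟨fun a ha b hb hab => hG a (hmem a ha).1 b hb hab, hCk⟩, fun w hw =>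
      ⟨hG u huv.1 w hw (hmem w hw).2.1.symm, hG v huv.2 w hw (hmem w hw).2.2.symm⟩⟩
  · left
    intro a ha b hb hab
    have := hS ha hb hab
    rw [addEdge_adj] at this
    rw [mem_coe] at ha hb
    grind

/-- The set of vertices in the image of `f` with index satisfying `p` is a clique. -/
theorem isNClique_image_filter [DecidableEq V] {α : Type*} [Fintype α] {F : SimpleGraph α}
    {f : α → V} (hf : Function.Injective f) (hadj : ∀ a b, F.Adj a b → G.Adj (f a) (f b))
    (p : α → Prop) [DecidablePred p] (hp : ∀ a b, p a → p b → a ≠ b → F.Adj a b) :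
    G.IsNClique #{a | p a} (({a | p a} : Finset α).image f) := by
  refine ⟨?_, card_image_of_injective _ hf⟩
  intro a ha b hb hab
  simp only [coe_image, coe_filter, mem_univ, true_and, Set.mem_image, Set.mem_ofPred_eq] at ha hb
  obtain ⟨i, hi, rfl⟩ := ha
  obtain ⟨j, hj, rfl⟩ := hb
  exact hadj _ _ (hp i j hi hj fun h => hab (h ▸ rfl))

theorem card_filter_le_val (n m : ℕ) : #{i : Fin n | m ≤ (i : ℕ)} = n - m := by
  have h := card_filter_add_card_filter_not (s := (univ : Finset (Fin n))) fun i => (i : ℕ) < m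
  simp only [Fin.card_filter_val_lt, card_univ, Fintype.card_fin, not_lt] at h
  omega

theorem exists_common_clique_of_dumbbell [DecidableEq V] (hm : k + 2 ≤ m)
    (h : ¬ ContainsCopy (dumbbell m) G) (h' : ContainsCopy (dumbbell m) (addEdge G u v))
    (hu : ∀ S, G.IsNClique m S → u ∉ S) :
    ∃ C, G.IsNClique k C ∧ ∀ w ∈ C, G.Adj u w ∧ G.Adj v w := by
  obtain ⟨f, hf, hadj⟩ := h'
  have h1 := isNClique_image_filter hf hadj (fun i => (i : ℕ) < m) (by simp +contextual [dumbbell])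
  have h2 := isNClique_image_filter hf hadj (fun i => m ≤ (i : ℕ)) (by simp +contextual [dumbbell])
  rw [Fin.card_filter_val_lt, min_eq_right (by omega)] at h1
  rw [card_filter_le_val, show 2 * m - m = m by omega] at h2
  rcases isClique_or_exists_of_isClique_addEdge h1.isClique (h1.card_eq ▸ hm) with hc1 | hC
  swap
  · exact hC
  rcases isClique_or_exists_of_isClique_addEdge h2.isClique (h2.card_eq ▸ hm) with hc2 | hC
  swap
  · exact hC
  have hu1 := hu _ ⟨hc1, h1.card_eq⟩
  have hu2 := hu _ ⟨hc2, h2.card_eq⟩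
  have hfu : ∀ i, f i ≠ u := by
    intro i hi
    rcases lt_or_ge (i : ℕ) m with him | him
    · exact hu1 (mem_image.2 ⟨i, by simpa using him, hi⟩)
    · exact hu2 (mem_image.2 ⟨i, by simpa using him, hi⟩)
  refine (h ⟨f, hf, fun a b hab => ?_⟩).elim
  have := hadj a b hab
  rw [addEdge_adj] at this
  have := hfu a
  have := hfu b
  tauto

theorem exists_common_clique_of_VgraphGen [DecidableEq V] (hk : k + 1 ≤ m - r) (hr : 1 ≤ r)
    (h : ¬ ContainsCopy (VgraphGen m r) G) (h' : ContainsCopy (VgraphGen m r) (addEdge G u v)) :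
    ∃ C, G.IsNClique k C ∧ ∀ w ∈ C, G.Adj u w ∧ G.Adj v w := by
  obtain ⟨f, hf, hadj⟩ := h'
  have h1 := isNClique_image_filter hf hadj (fun i => (i : ℕ) < m)
    (by simp +contextual [VgraphGen])
  have h2 := isNClique_image_filter hf hadj (fun i => (i : ℕ) = 0 ∨ m ≤ (i : ℕ))
    (by simp +contextual [VgraphGen])
  rw [Fin.card_filter_val_lt, min_eq_right (by omega)] at h1
  have hcard : k + 2 ≤ #{i : Fin (m + (m - r)) | (i : ℕ) = 0 ∨ m ≤ (i : ℕ)} := by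
    have hins : insert ⟨0, by omega⟩ ({i | m ≤ (i : ℕ)} : Finset (Fin (m + (m - r)))) ⊆
        ({i : Fin (m + (m - r)) | (i : ℕ) = 0 ∨ m ≤ (i : ℕ)} : Finset _) := by
      intro i hi
      simp only [mem_insert, mem_filter, mem_univ, true_and] at hi ⊢
      exact hi.imp_left fun h => by rw [h]
    have := card_le_card hins
    rw [card_insert_of_notMem (by simp; omega), card_filter_le_val] at this
    omega
  rcases isClique_or_exists_of_isClique_addEdge h1.isClique
    (show k + 2 ≤ _ by rw [h1.card_eq]; omega) with hc1 | hC
  swap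
  · exact hC
  rcases isClique_or_exists_of_isClique_addEdge h2.isClique (h2.card_eq ▸ hcard) with hc2 | hC
  swap
  · exact hC
  refine (h (containsCopy_fromRel f hf fun a b hne hab => ?_)).elim
  rcases hab with ⟨ha, hb⟩ | ⟨ha, hb⟩
  · exact hc1 (mem_image_of_mem f (by simpa using ha)) (mem_image_of_mem f (by simpa using hb))
      (hf.ne hne)
  · exact hc2 (mem_image_of_mem f (by simpa using ha)) (mem_image_of_mem f (by simpa using hb))
      (hf.ne hne)

theorem exists_common_clique_of_lambdaGraphGen [DecidableEq V] (hm : k + 2 ≤ m) (hrm : r ≤ m)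
    (h : ¬ ContainsCopy (lambdaGraphGen m r) G)
    (h' : ContainsCopy (lambdaGraphGen m r) (addEdge G u v))
    (hu : ∀ S, G.IsNClique m S → u ∉ S) :
    (∃ C, G.IsNClique k C ∧ ∀ w ∈ C, G.Adj u w ∧ G.Adj v w) ∨
      (∃ S, G.IsNClique m S ∧ v ∈ S) ∧
        ∃ C, G.IsNClique (r - 1) C ∧ ∀ w ∈ C, G.Adj u w ∧ G.Adj v w := by
  obtain ⟨f, hf, hadj⟩ := h'
  have h1 := isNClique_image_filter hf hadj (fun i => (i : ℕ) < m)
    (by simp +contextual [lambdaGraphGen])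
  rw [Fin.card_filter_val_lt, min_eq_right (by omega)] at h1
  rcases isClique_or_exists_of_isClique_addEdge h1.isClique (h1.card_eq ▸ hm) with hc1 | hC
  swap
  · exact Or.inl hC
  right
  set S := image f {i | (i : ℕ) < m} with hS
  have hSm : G.IsNClique m S := ⟨hc1, h1.card_eq⟩
  have huS := hu S hSm
  have hmem : ∀ i : Fin (m + 1), (i : ℕ) < m → f i ∈ S := fun i hi =>
    mem_image_of_mem f (by simpa using hi)
  have hapex : ∀ b : Fin (m + 1), (b : ℕ) < r → f (Fin.last m) = u ∧ f b = v ∨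
      G.Adj (f (Fin.last m)) (f b) := by
    intro b hb
    have hne : Fin.last m ≠ b := fun h => by simp [← h] at hb; omega
    have := hadj (Fin.last m) b (by simp [lambdaGraphGen, hb, hne])
    rw [addEdge_adj] at this
    have hbu : f b ≠ u := fun h => huS (h ▸ hmem b (hb.trans_le hrm))
    tauto
  obtain ⟨b₀, hb₀, hau, hbv⟩ : ∃ b : Fin (m + 1), (b : ℕ) < r ∧
      f (Fin.last m) = u ∧ f b = v := by
    by_contra hcon
    refine h (containsCopy_fromRel f hf fun a b hne hab => ?_)
    rcases hab with ⟨ha, hb⟩ | ⟨ha, hb⟩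
    · exact hc1 (hmem a ha) (hmem b hb) (hf.ne hne)
    · obtain rfl : a = Fin.last m := Fin.ext ha
      exact (hapex b hb).resolve_left fun h => hcon ⟨b, hb, h⟩
  have hvS : v ∈ S := hbv ▸ hmem b₀ (hb₀.trans_le hrm)
  have hC : ∀ w ∈ image f (({i | (i : ℕ) < r} : Finset (Fin (m + 1))).erase b₀),
      w ∈ S ∧ w ≠ v ∧ G.Adj u w := by
    intro w hw
    obtain ⟨b, hb, rfl⟩ := mem_image.1 hw
    simp only [mem_erase, mem_filter, mem_univ, true_and] at hb
    have hne : f b ≠ v := hbv ▸ hf.ne hb.1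
    refine ⟨hmem b (hb.2.trans_le hrm), hne, ?_⟩
    simpa [hne, hau] using hapex b hb.2
  refine ⟨⟨S, hSm, hvS⟩, _, ⟨fun a ha b hb hab => hc1 (hC a ha).1 (hC b hb).1 hab, ?_⟩,
    fun w hw => ⟨(hC w hw).2.2, hc1 hvS (hC w hw).1 (hC w hw).2.1.symm⟩⟩
  rw [card_image_of_injective _ hf, card_erase_of_mem (by simpa using hb₀),
    Fin.card_filter_val_lt, min_eq_right (by omega)]

/-- In a saturated graph, nonadjacent vertices have large cliques in their common neighbourhood. -/
theorem FamSat3.exists_common_clique [DecidableEq V] (hr : 1 ≤ r) (hm : 2 * r ≤ m)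
    (hG : FamSat3 (dumbbell m) (VgraphGen m r) (lambdaGraphGen m r) G)
    (hu : ∀ S, G.IsNClique m S → u ∉ S) (huv : u ≠ v) (hadj : ¬ G.Adj u v) :
    (∃ C, G.IsNClique (m - r - 1) C ∧ ∀ w ∈ C, G.Adj u w ∧ G.Adj v w) ∨
      (∃ S, G.IsNClique m S ∧ v ∈ S) ∧
        ∃ C, G.IsNClique (r - 1) C ∧ ∀ w ∈ C, G.Adj u w ∧ G.Adj v w := by
  obtain ⟨hB, hV, hL, hsat⟩ := hG
  rcases hsat u v huv hadj with h | h | h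
  · exact Or.inl (exists_common_clique_of_dumbbell (by omega) hB h hu)
  · exact Or.inl (exists_common_clique_of_VgraphGen (by omega) hr hV h)
  · exact exists_common_clique_of_lambdaGraphGen (by omega) (by omega) hL h hu

theorem FamSat3.eq_of_inter_nonempty [DecidableEq V] (hrm : r ≤ m)
    (hG : FamSat3 (dumbbell m) (VgraphGen m r) (lambdaGraphGen m r) G)
    (hS : G.IsNClique m S) (hS' : G.IsNClique m S') (hx : x ∈ S) (hx' : x ∈ S') : S = S' := by
  obtain ⟨-, hV, hL, -⟩ := hG
  by_contra hne
  have hsub : ¬ S' ⊆ S := fun h => hne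
    (eq_of_subset_of_card_le h (by rw [hS.card_eq, hS'.card_eq])).symm
  obtain ⟨a, ha', ha⟩ := not_subset.1 hsub
  rcases le_or_gt r #(S ∩ S') with hle | hlt
  · obtain ⟨T, hT, hTr⟩ := exists_subset_card_eq hle
    refine hL (containsCopy_lambdaGraphGen hS ha (hT.trans inter_subset_left) hTr fun y hy => ?_)
    have hy := mem_inter.1 (hT hy)
    exact hS'.isClique ha' hy.2 fun h => ha (h ▸ hy.1)
  · have hle : m - r ≤ #(S' \ S) := by
      rw [card_sdiff, hS'.card_eq]
      omega
    obtain ⟨T, hT, hTr⟩ := exists_subset_card_eq hle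
    refine hV (containsCopy_VgraphGen hS hx (hS'.isClique.subset ?_) hTr ?_)
    · exact Set.insert_subset hx' fun y hy => (mem_sdiff.1 (hT hy)).1
    · exact disjoint_sdiff.mono_right hT

theorem FamSat3.eq_of_adj [DecidableEq V] (hrm : r ≤ m)
    (hG : FamSat3 (dumbbell m) (VgraphGen m r) (lambdaGraphGen m r) G)
    (hS : G.IsNClique m S) (hS' : G.IsNClique m S') (hx : x ∈ S) (hy : y ∈ S')
    (hxy : G.Adj x y) : S = S' := by
  by_cases h : Disjoint S S'
  · exact (hG.1 (containsCopy_dumbbell hS hS' h hx hy hxy)).elim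
  · obtain ⟨z, hz, hz'⟩ := not_disjoint_iff.1 h
    exact hG.eq_of_inter_nonempty hrm hS hS' hz hz'

/-- A vertex outside all `m`-cliques forces, for every `m`-clique `S`, an `r`-clique that meets `S`
but is not contained in it. -/
theorem FamSat3.exists_isNClique_meeting [DecidableEq V] (hr : 2 ≤ r) (hm : 2 * r ≤ m)
    (hG : FamSat3 (dumbbell m) (VgraphGen m r) (lambdaGraphGen m r) G)
    (hu : ∀ S, G.IsNClique m S → u ∉ S) (hS : G.IsNClique m S) :
    ∃ t, G.IsNClique r t ∧ (t ∩ S).Nonempty ∧ ¬ t ⊆ S := by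
  obtain ⟨v, hv, hadj⟩ : ∃ v ∈ S, ¬ G.Adj u v := by
    by_contra! hcon
    obtain ⟨T, hT, hTr⟩ := exists_subset_card_eq (show r ≤ #S by rw [hS.card_eq]; omega)
    exact hG.2.2.1 (containsCopy_lambdaGraphGen hS (hu S hS) hT hTr fun y hy => hcon y (hT hy))
  have huv : u ≠ v := fun h => hu S hS (h ▸ hv)
  have hcommon : ∃ C, G.IsNClique (r - 1) C ∧ ∀ w ∈ C, G.Adj u w ∧ G.Adj v w := by
    rcases hG.exists_common_clique (by omega) hm hu huv hadj with ⟨C, hC, hw⟩ | ⟨-, h⟩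
    · obtain ⟨T, hT, hTr⟩ := exists_subset_card_eq (show r - 1 ≤ #C by rw [hC.card_eq]; omega)
      exact ⟨T, ⟨hC.isClique.subset hT, hTr⟩, fun w h => hw w (hT h)⟩
    · exact h
  obtain ⟨C, hC, hw⟩ := hcommon
  have hr1 : r - 1 + 1 = r := by omega
  by_cases hCS : (C ∩ S).Nonempty
  · refine ⟨insert u C, hr1 ▸ hC.insert fun w h => (hw w h).1, ?_, fun h =>
      hu S hS (h (mem_insert_self u C))⟩
    exact hCS.mono (inter_subset_inter_right (subset_insert _ _))
  · refine ⟨insert v C, hr1 ▸ hC.insert fun w h => (hw w h).2,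
      ⟨v, mem_inter.2 ⟨mem_insert_self v C, hv⟩⟩, fun h => ?_⟩
    obtain ⟨w, hwC⟩ := card_pos.1 (show 0 < #C by rw [hC.card_eq]; omega)
    exact hCS ⟨w, mem_inter.2 ⟨hwC, h (mem_insert_of_mem hwC)⟩⟩

end Structure

section Counting

variable [Fintype V] [DecidableEq V] {G : SimpleGraph V} [DecidableRel G.Adj] {m r k T : ℕ}
  {R L : Finset V}

theorem card_mul_le_of_le_card_cliques
    (hR : ∀ v ∈ R, T ≤ #{t ∈ G.cliqueFinset r | v ∈ t}) (hRL : R ⊆ L) :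
    #R * T ≤ #{t ∈ G.cliqueFinset r | (t ∩ L).Nonempty} * r := by
  refine card_mul_le_card_mul (fun v t => v ∈ t) (fun v hv => (hR v hv).trans ?_) fun t ht => ?_
  · refine card_le_card fun t ht => ?_
    simp only [mem_filter, mem_bipartiteAbove] at ht ⊢
    exact ⟨⟨ht.1, v, mem_inter.2 ⟨ht.2, hRL hv⟩⟩, ht.2⟩
  · rw [← (mem_cliqueFinset_iff.1 (mem_filter.1 ht).1).card_eq]
    exact card_le_card fun v hv => (mem_filter.1 hv).2

/-- If any two nonadjacent vertices of `R` have a `k`-clique in their common neighbourhood and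
every vertex of `L ⊆ R` is in few `r`-cliques, then almost every vertex of `L` is in
`k.choose (r-1)` `r`-cliques whose other vertices belong to a fixed set. -/
theorem card_sub_mul_choose_le (hr : 2 ≤ r) (hk : r - 1 ≤ k) (hLR : L ⊆ R)
    (hL : ∀ v ∈ L, #{t ∈ G.cliqueFinset r | v ∈ t} ≤ T)
    (hcommon : ∀ u ∈ R, ∀ v ∈ R, u ≠ v → ¬ G.Adj u v →
      ∃ C, G.IsNClique k C ∧ ∀ w ∈ C, G.Adj u w ∧ G.Adj v w) :
    (#L - r * (T * r + 1)) * k.choose (r - 1) ≤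
      #{t ∈ G.cliqueFinset r | (t ∩ R).Nonempty} := by
  classical
  set bad : V → V → Prop := fun u v => G.Adj u v ∧ ∀ t, G.IsNClique r t → u ∈ t → v ∉ t with hbad
  set nbd : V → Finset V := fun u => insert u ({t ∈ G.cliqueFinset r | u ∈ t}.biUnion id)
    with hnbd
  have hr1 : r - 1 + 1 = r := by omega
  obtain ⟨S, hS, hSmax⟩ := exists_max_image
    {S ∈ L.powerset | ∀ a ∈ S, ∀ b ∈ S, a ≠ b → bad a b} card ⟨∅, by simp⟩
  simp only [mem_filter, mem_powerset] at hS hSmax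
  obtain ⟨hSL, hSbad⟩ := hS
  have hSr : #S ≤ r := by
    by_contra! hlt
    obtain ⟨t, htS, htr⟩ := exists_subset_card_eq hlt.le
    have ht : G.IsNClique r t :=
      ⟨fun a ha b hb hab => (hSbad a (htS ha) b (htS hb) hab).1, htr⟩
    obtain ⟨a, ha, b, hb, hab⟩ := one_lt_card.1 (show 1 < #t by omega)
    exact (hSbad a (htS ha) b (htS hb) hab).2 t ht ha hb
  set N := S.biUnion nbd with hN
  have hNcard : #N ≤ r * (T * r + 1) := by
    refine (card_biUnion_le_card_mul _ _ (T * r + 1) fun u hu => ?_).trans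
      (Nat.mul_le_mul_right _ hSr)
    refine (card_insert_le _ _).trans (Nat.add_le_add_right ?_ 1)
    refine (card_biUnion_le_card_mul _ _ r fun t ht => ?_).trans
      (Nat.mul_le_mul_right _ (hL u (hSL hu)))
    exact (mem_cliqueFinset_iff.1 (mem_filter.1 ht).1).card_eq.le
  have hclique : ∀ v ∈ L \ N, ∃ C ⊆ N, G.IsNClique k C ∧ ∀ w ∈ C, G.Adj v w := by
    intro v hv
    obtain ⟨hvL, hvN⟩ := mem_sdiff.1 hv
    have hvS : v ∉ S := fun h => hvN (mem_biUnion.2 ⟨v, h, mem_insert_self _ _⟩)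
    obtain ⟨u, hu, huv⟩ : ∃ u ∈ S, ¬ bad u v := by
      by_contra! hcon
      have := hSmax (insert v S) ⟨insert_subset hvL hSL, ?_⟩
      · rw [card_insert_of_notMem hvS] at this
        omega
      · have hsymm : ∀ a b, bad a b → bad b a := fun a b h =>
          ⟨h.1.symm, fun t ht hb ha => h.2 t ht ha hb⟩
        intro a ha b hb hab
        rw [mem_insert] at ha hb
        rcases ha with rfl | ha <;> rcases hb with rfl | hb
        · exact (hab rfl).elim
        · exact hsymm _ _ (hcon b hb)
        · exact hcon a ha
        · exact hSbad a ha b hb hab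
    have hnadj : ¬ G.Adj u v := by
      intro hadj
      refine huv ⟨hadj, fun t ht hut hvt => hvN (mem_biUnion.2 ⟨u, hu, mem_insert_of_mem ?_⟩)⟩
      exact mem_biUnion.2 ⟨t, mem_filter.2 ⟨mem_cliqueFinset_iff.2 ht, hut⟩, hvt⟩
    obtain ⟨C, hC, hCadj⟩ := hcommon u (hLR (hSL hu)) v (hLR hvL) (fun h => hvS (h ▸ hu)) hnadj
    refine ⟨C, fun w hw => mem_biUnion.2 ⟨u, hu, mem_insert_of_mem ?_⟩, hC, fun w hw =>
      (hCadj w hw).2⟩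
    obtain ⟨B, hwB, hBC, hB⟩ := exists_subsuperset_card_eq (singleton_subset_iff.2 hw)
      (show #{w} ≤ r - 1 by rw [card_singleton]; omega) (hC.card_eq ▸ hk)
    refine mem_biUnion.2 ⟨insert u B, mem_filter.2 ⟨mem_cliqueFinset_iff.2 ?_,
      mem_insert_self _ _⟩, mem_insert_of_mem (hwB (mem_singleton_self w))⟩
    exact hr1 ▸ IsNClique.insert ⟨hC.isClique.subset hBC, hB⟩ fun x hx => (hCadj x (hBC hx)).1
  have hcount : ∀ v ∈ L \ N,
      k.choose (r - 1) ≤ #{t ∈ G.cliqueFinset r | v ∈ t ∧ t ⊆ insert v N} := by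
    intro v hv
    obtain ⟨C, hCN, hC, hadj⟩ := hclique v hv
    have hvC : v ∉ C := fun h => (mem_sdiff.1 hv).2 (hCN h)
    rw [← hC.card_eq, ← card_powersetCard]
    refine card_le_card_of_injOn (insert v) (fun B hB => ?_) fun B hB B' hB' h => ?_
    · obtain ⟨hBC, hBr⟩ := mem_powersetCard.1 hB
      refine mem_filter.2 ⟨mem_cliqueFinset_iff.2 ?_, mem_insert_self _ _,
        insert_subset_insert _ (hBC.trans hCN)⟩
      exact hr1 ▸ IsNClique.insert ⟨hC.isClique.subset hBC, hBr⟩ fun x hx => hadj x (hBC hx)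
    · have h1 : v ∉ B := fun h => hvC ((mem_powersetCard.1 hB).1 h)
      have h2 : v ∉ B' := fun h => hvC ((mem_powersetCard.1 hB').1 h)
      rw [← erase_insert h1, ← erase_insert h2]
      exact congrArg (fun s => s.erase v) h
  calc (#L - r * (T * r + 1)) * k.choose (r - 1) ≤ #(L \ N) * k.choose (r - 1) := by
        refine Nat.mul_le_mul_right _ ?_
        have := le_card_sdiff N L
        omega
    _ ≤ ∑ v ∈ L \ N, #{t ∈ G.cliqueFinset r | v ∈ t ∧ t ⊆ insert v N} := by
        rw [← smul_eq_mul]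
        exact card_nsmul_le_sum _ _ _ hcount
    _ = #((L \ N).biUnion fun v => {t ∈ G.cliqueFinset r | v ∈ t ∧ t ⊆ insert v N}) := by
        refine (card_biUnion fun v hv w hw hvw => ?_).symm
        refine disjoint_left.2 fun t ht ht' => ?_
        have h1 := (mem_filter.1 ht).2.1
        have h2 := (mem_filter.1 ht').2.2 h1
        rcases mem_insert.1 h2 with h | h
        · exact hvw h
        · exact (mem_sdiff.1 hv).2 h
    _ ≤ _ := by
        refine card_le_card fun t ht => ?_
        obtain ⟨v, hv, ht⟩ := mem_biUnion.1 ht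
        obtain ⟨ht, hvt, -⟩ := mem_filter.1 ht
        exact mem_filter.2 ⟨ht, v, mem_inter.2 ⟨hvt, hLR (mem_sdiff.1 hv).1⟩⟩

variable (G m) in
/-- The vertices which are in no `m`-clique. -/
def uncoveredVertices : Finset V :=
  univ \ (G.cliqueFinset m).biUnion id

theorem mem_uncoveredVertices {u : V} :
    u ∈ uncoveredVertices G m ↔ ∀ S, G.IsNClique m S → u ∉ S := by
  simp [uncoveredVertices]

theorem FamSat3.pairwiseDisjoint_cliqueFinset
    (hG : FamSat3 (dumbbell m) (VgraphGen m r) (lambdaGraphGen m r) G)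
    (hrm : r ≤ m) :
    (G.cliqueFinset m : Set (Finset V)).PairwiseDisjoint id := by
  intro S hS S' hS' hne
  refine disjoint_left.2 fun x hx hx' => hne ?_
  rw [mem_coe, mem_cliqueFinset_iff] at hS hS'
  exact hG.eq_of_inter_nonempty hrm hS hS' hx hx'

theorem FamSat3.card_vertices
    (hG : FamSat3 (dumbbell m) (VgraphGen m r) (lambdaGraphGen m r) G)
    (hrm : r ≤ m) :
    Fintype.card V = #(G.cliqueFinset m) * m + #(uncoveredVertices G m) := by
  have h : #((G.cliqueFinset m).biUnion id) = #(G.cliqueFinset m) * m := by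
    rw [card_biUnion (hG.pairwiseDisjoint_cliqueFinset hrm)]
    exact sum_const_nat fun S hS => (mem_cliqueFinset_iff.1 hS).card_eq
  rw [uncoveredVertices, card_sdiff_of_subset (subset_univ _), h, card_univ, ← h]
  have := card_le_univ ((G.cliqueFinset m).biUnion id)
  omega

theorem FamSat3.card_mul_choose_add_one_le
    (hG : FamSat3 (dumbbell m) (VgraphGen m r) (lambdaGraphGen m r) G)
    (hr : 2 ≤ r) (hm : 2 * r ≤ m)
    (hne : (uncoveredVertices G m).Nonempty) :
    #(G.cliqueFinset m) * (m.choose r + 1) ≤ #(G.cliqueFinset r) := by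
  obtain ⟨u, hu⟩ := hne
  rw [mem_uncoveredVertices] at hu
  calc #(G.cliqueFinset m) * (m.choose r + 1)
      ≤ ∑ S ∈ G.cliqueFinset m, #{t ∈ G.cliqueFinset r | (t ∩ S).Nonempty} := by
        rw [← smul_eq_mul]
        refine card_nsmul_le_sum _ _ _ fun S hS => ?_
        rw [mem_cliqueFinset_iff] at hS
        obtain ⟨t, ht, htS, hsub⟩ := hG.exists_isNClique_meeting hr hm hu hS
        have hnot : t ∉ powersetCard r S := fun h => hsub (mem_powersetCard.1 h).1
        rw [← hS.card_eq, ← card_powersetCard, ← card_insert_of_notMem hnot]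
        refine card_le_card (insert_subset ?_ fun t' ht' => ?_)
        · exact mem_filter.2 ⟨mem_cliqueFinset_iff.2 ht, htS⟩
        · obtain ⟨hsub', hcard⟩ := mem_powersetCard.1 ht'
          refine mem_filter.2 ⟨mem_cliqueFinset_iff.2 ⟨hS.isClique.subset hsub', hcard⟩, ?_⟩
          rw [inter_eq_left.2 hsub', ← card_pos]
          omega
    _ = #((G.cliqueFinset m).biUnion fun S => {t ∈ G.cliqueFinset r | (t ∩ S).Nonempty}) := by
        refine (card_biUnion fun S hS S' hS' hne => disjoint_left.2 fun t ht ht' => hne ?_).symm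
        rw [mem_coe, mem_cliqueFinset_iff] at hS hS'
        obtain ⟨ht, x, hx⟩ := mem_filter.1 ht
        obtain ⟨-, y, hy⟩ := mem_filter.1 ht'
        rw [mem_inter] at hx hy
        by_cases hxy : x = y
        · exact hG.eq_of_inter_nonempty (by omega) hS hS' hx.2 (hxy ▸ hy.2)
        · exact hG.eq_of_adj (by omega) hS hS' hx.2 hy.2
            ((mem_cliqueFinset_iff.1 ht).isClique hx.1 hy.1 hxy)
    _ ≤ _ := card_le_card (biUnion_subset.2 fun S _ => filter_subset _ _)

theorem FamSat3.card_mul_choose_add_le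
    (hG : FamSat3 (dumbbell m) (VgraphGen m r) (lambdaGraphGen m r) G)
    (hr : 1 ≤ r) (hrm : r ≤ m) :
    #(G.cliqueFinset m) * m.choose r +
      #{t ∈ G.cliqueFinset r | (t ∩ uncoveredVertices G m).Nonempty} ≤ #(G.cliqueFinset r) := by
  have h : #(G.cliqueFinset m) * m.choose r =
      #((G.cliqueFinset m).biUnion fun S => powersetCard r S) := by
    rw [card_biUnion]
    · refine (sum_const_nat fun S hS => ?_).symm
      rw [card_powersetCard, (mem_cliqueFinset_iff.1 hS).card_eq]
    · intro S hS S' hS' hne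
      refine disjoint_left.2 fun t ht ht' => ?_
      rw [mem_powersetCard] at ht ht'
      obtain ⟨x, hx⟩ := card_pos.1 (show 0 < #t by omega)
      exact disjoint_left.1 (hG.pairwiseDisjoint_cliqueFinset hrm hS hS' hne) (ht.1 hx) (ht'.1 hx)
  rw [h, ← card_union_of_disjoint]
  · refine card_le_card (union_subset (biUnion_subset.2 fun S hS t ht => ?_) (filter_subset _ _))
    rw [mem_powersetCard] at ht
    rw [mem_cliqueFinset_iff] at hS ⊢
    exact ⟨hS.isClique.subset ht.1, ht.2⟩
  · refine disjoint_left.2 fun t ht ht' => ?_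
    obtain ⟨S, hS, htS⟩ := mem_biUnion.1 ht
    obtain ⟨x, hx⟩ := (mem_filter.1 ht').2
    rw [mem_inter, mem_uncoveredVertices] at hx
    exact hx.2 S (mem_cliqueFinset_iff.1 hS) ((mem_powersetCard.1 htS).1 hx.1)

end Counting

section LowerBound

theorem choose_add_succ_le (a s j : ℕ) :
    (a + j).choose (s + 1) ≤ a.choose (s + 1) + j * (a + j - 1).choose s := by
  induction j with
  | zero => simp
  | succ j ih =>
    have h1 : (a + j + 1).choose (s + 1) = (a + j).choose s + (a + j).choose (s + 1) :=
      Nat.choose_succ_succ _ _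
    have h2 : j * (a + j - 1).choose s ≤ j * (a + j).choose s :=
      Nat.mul_le_mul_left _ (Nat.choose_le_choose _ (Nat.sub_le _ _))
    rw [← add_assoc, h1, Nat.add_sub_cancel, Nat.succ_mul]
    omega

theorem choose_le_two_mul_choose {m r : ℕ} (hr : 2 ≤ r) (hm : 2 * r ^ 2 ≤ m) :
    (m - 1).choose (r - 1) ≤ 2 * (m - r - 1).choose (r - 1) := by
  obtain ⟨s, rfl⟩ : ∃ s, r = s + 2 := ⟨r - 2, by omega⟩
  obtain ⟨a, rfl⟩ : ∃ a, m = a + (s + 2) + 1 := ⟨m - (s + 2) - 1, by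
    have : 2 * (s + 2) ≤ 2 * (s + 2) ^ 2 := by nlinarith
    omega⟩
  have h1 := choose_add_succ_le a s (s + 2)
  have h2 := Nat.add_one_mul_choose_eq (a + s + 1) s
  rw [show a + (s + 2) = a + s + 1 + 1 by omega, Nat.add_sub_cancel] at h1
  rw [show a + (s + 2) + 1 - 1 = a + s + 1 + 1 by omega,
    show a + (s + 2) + 1 - (s + 2) - 1 = a by omega, show s + 2 - 1 = s + 1 by omega]
  have h3 : 2 * ((s + 2) * (a + s + 1).choose s) ≤ (a + s + 1 + 1).choose (s + 1) := by
    refine Nat.le_of_mul_le_mul_right (c := s + 1) ?_ (by omega)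
    rw [← h2]
    have : 2 * (s + 2) * (s + 1) ≤ a + s + 1 + 1 := by nlinarith
    calc 2 * ((s + 2) * (a + s + 1).choose s) * (s + 1)
        = (2 * (s + 2) * (s + 1)) * (a + s + 1).choose s := by ring
      _ ≤ _ := Nat.mul_le_mul_right _ this
  omega

/-- If not all vertices are covered by `m`-cliques, then a saturated graph has significantly more
`r`-cliques than a disjoint union of `m`-cliques. -/
theorem FamSat3.lower_bound [Fintype V] [DecidableEq V] {G : SimpleGraph V} [DecidableRel G.Adj]
    {m r : ℕ} (hr : 3 ≤ r) (hm : 2 * r ^ 2 ≤ m)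
    (hG : FamSat3 (dumbbell m) (VgraphGen m r) (lambdaGraphGen m r) G)
    (hne : (uncoveredVertices G m).Nonempty) :
    6 * m.choose r * (m.choose r + 1) * Fintype.card V ≤
      (6 * m.choose r + 5) * m * #(G.cliqueFinset r) +
        6 * m.choose r * (m.choose r + 1) *
          (r * (2 * r * (m - 1).choose (r - 1) * r + 1)) := by
  have hm2 : 2 * r ≤ m := by nlinarith
  have hmr : r - 1 ≤ m - r - 1 := by
    have : 2 * r ^ 2 = 2 * r * r := by ring
    have : 2 * r * 3 ≤ 2 * r * r := Nat.mul_le_mul_left _ hr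
    omega
  have hcard := hG.card_vertices (by omega)
  have hA := hG.card_mul_choose_add_one_le (by omega) hm2 hne
  have hB := hG.card_mul_choose_add_le (by omega) (by omega)
  have hC := choose_le_two_mul_choose (by omega) hm
  have hM : m.choose r * r = m * (m - 1).choose (r - 1) := by
    have := Nat.add_one_mul_choose_eq (m - 1) (r - 1)
    rw [show m - 1 + 1 = m by omega, show r - 1 + 1 = r by omega] at this
    exact this.symm
  set C := (m - 1).choose (r - 1)
  set R := uncoveredVertices G m with hR
  set X := #{t ∈ G.cliqueFinset r | (t ∩ R).Nonempty}
  set H := {v ∈ R | 2 * r * C ≤ #{t ∈ G.cliqueFinset r | v ∈ t}}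
  set L := {v ∈ R | ¬ 2 * r * C ≤ #{t ∈ G.cliqueFinset r | v ∈ t}}
  have hHL : #H + #L = #R := card_filter_add_card_filter_not _
  have hH : #H * (2 * r * C) ≤ X * r :=
    card_mul_le_of_le_card_cliques (fun v hv => (mem_filter.1 hv).2) (filter_subset _ _ : H ⊆ R)
  have hL : (#L - r * (2 * r * C * r + 1)) * (m - r - 1).choose (r - 1) ≤ X := by
    refine card_sub_mul_choose_le (by omega) hmr (filter_subset _ _ : L ⊆ R)
      (fun v hv => (not_le.1 (mem_filter.1 hv).2).le) fun u hu v hv huv hadj => ?_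
    rw [hR, mem_uncoveredVertices] at hu hv
    rcases hG.exists_common_clique (by omega) hm2 hu huv hadj with h | ⟨⟨S, hS, hvS⟩, -⟩
    · exact h
    · exact (hv S hS hvS).elim
  rw [hcard]
  set c := r * (2 * r * C * r + 1)
  set M := m.choose r
  set N := #(G.cliqueFinset r)
  set k := #(G.cliqueFinset m)
  have hH' : 2 * C * #H ≤ X := by
    refine Nat.le_of_mul_le_mul_right (c := r) ?_ (by omega)
    linarith
  have hL' : #L * C ≤ 2 * X + c * C := by
    have h1 : #L * C ≤ (#L - c + c) * C := Nat.mul_le_mul_right _ (by omega)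
    have h2 : (#L - c) * C ≤ (#L - c) * (2 * (m - r - 1).choose (r - 1)) :=
      Nat.mul_le_mul_left _ hC
    linarith
  have hX : 2 * C * #R ≤ 5 * X + 2 * C * c := by
    rw [← hHL]
    linarith
  have hrX : 3 * X ≤ r * X := Nat.mul_le_mul_right _ hr
  have hkey : 5 * M * (k * m + #R) + M * #R ≤ 5 * m * N + 6 * M * c := by
    refine Nat.le_of_mul_le_mul_right (c := r) ?_ (by omega)
    have h1 : 5 * C * (k * m + #R) + C * #R ≤ 5 * r * N + 6 * C * c := by
      have h2 := Nat.mul_le_mul_left r hB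
      have h3 : r * (k * M + X) = k * (m * C) + r * X := by rw [← hM]; ring
      linarith
    calc (5 * M * (k * m + #R) + M * #R) * r
        = (M * r) * (5 * (k * m + #R) + #R) := by ring
      _ = m * (5 * C * (k * m + #R) + C * #R) := by rw [hM]; ring
      _ ≤ m * (5 * r * N + 6 * C * c) := Nat.mul_le_mul_left _ h1
      _ = 5 * m * N * r + 6 * (m * C) * c := by ring
      _ = (5 * m * N + 6 * M * c) * r := by rw [← hM]; ring
  have h1 := Nat.mul_le_mul_left (M + 1) hkey
  have h2 := Nat.mul_le_mul_left (M * m) hA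
  linarith

end LowerBound

section Existence

variable {m r : ℕ}

theorem not_containsCopy_bot {α : Type*} {F : SimpleGraph α} {a b : α} (h : F.Adj a b) :
    ¬ ContainsCopy F (⊥ : SimpleGraph V) := fun ⟨_, _, hf⟩ => hf a b h

theorem exists_famSat3 [Finite V] {α₁ α₂ α₃ : Type*} {F₁ : SimpleGraph α₁} {F₂ : SimpleGraph α₂}
    {F₃ : SimpleGraph α₃} (h₁ : ¬ ContainsCopy F₁ (⊥ : SimpleGraph V))
    (h₂ : ¬ ContainsCopy F₂ (⊥ : SimpleGraph V)) (h₃ : ¬ ContainsCopy F₃ (⊥ : SimpleGraph V)) :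
    ∃ G : SimpleGraph V, FamSat3 F₁ F₂ F₃ G := by
  obtain ⟨G, hG⟩ := (Set.toFinite {G : SimpleGraph V | ¬ ContainsCopy F₁ G ∧
    ¬ ContainsCopy F₂ G ∧ ¬ ContainsCopy F₃ G}).exists_maximal ⟨⊥, h₁, h₂, h₃⟩
  refine ⟨G, hG.prop.1, hG.prop.2.1, hG.prop.2.2, fun u v huv hadj => ?_⟩
  by_contra! hcon
  have hle := hG.le_of_ge (y := addEdge G u v) hcon le_sup_left
  exact hadj (hle ((addEdge_adj G u v u v).2 (Or.inr ⟨Or.inl ⟨rfl, rfl⟩, huv⟩)))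

theorem cliqueCount_eq_card [Fintype V] [DecidableEq V] (G : SimpleGraph V) [DecidableRel G.Adj]
    (r : ℕ) : cliqueCount G r = #(G.cliqueFinset r) := by
  rw [cliqueCount, ← Set.ncard_coe_finset, coe_cliqueFinset]
  rfl

theorem exists_satCliquesFam3_eq (n : ℕ) (hr : 1 ≤ r) (hm : 2 ≤ m) :
    ∃ G : SimpleGraph (Fin n), FamSat3 (dumbbell m) (VgraphGen m r) (lambdaGraphGen m r) G ∧
      cliqueCount G r = satCliquesFam3 n r (dumbbell m) (VgraphGen m r) (lambdaGraphGen m r) := by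
  have h₁ : (dumbbell m).Adj ⟨0, by omega⟩ ⟨1, by omega⟩ := by
    simp [dumbbell]
    omega
  have h₂ : (VgraphGen m r).Adj ⟨0, by omega⟩ ⟨1, by omega⟩ := by
    simp [VgraphGen]
    omega
  have h₃ : (lambdaGraphGen m r).Adj ⟨0, by omega⟩ ⟨1, by omega⟩ := by
    simp [lambdaGraphGen]
    omega
  obtain ⟨G, hG⟩ := exists_famSat3 (V := Fin n) (not_containsCopy_bot h₁)
    (not_containsCopy_bot h₂) (not_containsCopy_bot h₃)
  exact Nat.sInf_mem (s := {k | ∃ G : SimpleGraph (Fin n),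
    FamSat3 (dumbbell m) (VgraphGen m r) (lambdaGraphGen m r) G ∧ cliqueCount G r = k})
    ⟨_, G, hG, rfl⟩

end Existence

section BlockGraph

variable {m r j : ℕ}

/-- The graph on `Fin n` whose components are cliques on consecutive blocks of `m` vertices. -/
def blockGraph (n m : ℕ) : SimpleGraph (Fin n) where
  Adj a b := a ≠ b ∧ (a : ℕ) / m = (b : ℕ) / m
  symm := ⟨fun _ _ h => ⟨h.1.symm, h.2.symm⟩⟩
  loopless := ⟨fun _ h => h.1 rfl⟩

/-- The `q`-th block of vertices of `blockGraph n m`. -/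
def block (n m q : ℕ) : Finset (Fin n) := {a | (a : ℕ) / m = q}

theorem mem_block {n q : ℕ} {a : Fin n} : a ∈ block n m q ↔ (a : ℕ) / m = q := by
  simp [block]

theorem card_block_le (n q : ℕ) (hm : 0 < m) : #(block n m q) ≤ m := by
  refine (card_le_card_of_injOn (t := range m) (fun a : Fin n => (a : ℕ) % m)
    (fun a _ => by simpa using Nat.mod_lt _ hm) fun a ha b hb hab => ?_).trans_eq (card_range m)
  have ha := mem_block.1 ha
  have hb := mem_block.1 hb
  ext
  rw [← Nat.div_add_mod (a : ℕ) m, ← Nat.div_add_mod (b : ℕ) m, ha, hb]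
  exact congrArg _ hab

theorem isNClique_block {q : ℕ} (hm : 0 < m) (hq : q < j) :
    (blockGraph (j * m) m).IsNClique m (block (j * m) m q) := by
  refine ⟨fun a ha b hb hab => ⟨hab, ?_⟩, (card_block_le _ _ hm).antisymm ?_⟩
  · rw [mem_block.1 ha, mem_block.1 hb]
  · have hlt : ∀ i : Fin m, m * q + i < j * m := fun i => by
      have := Nat.mul_le_mul_left m (Nat.succ_le_of_lt hq)
      rw [Nat.mul_succ] at this
      have := i.2
      rw [mul_comm j]
      omega
    have hinj : Function.Injective fun i : Fin m => (⟨m * q + i, hlt i⟩ : Fin (j * m)) := by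
      intro a b hab
      ext
      simpa using hab
    calc m = #(univ.image fun i : Fin m => (⟨m * q + i, hlt i⟩ : Fin (j * m))) := by
          rw [card_image_of_injective _ hinj, card_univ, Fintype.card_fin]
      _ ≤ _ := card_le_card fun x hx => by
          obtain ⟨i, -, rfl⟩ := mem_image.1 hx
          rw [mem_block]
          simp [Nat.mul_add_div hm, Nat.div_eq_of_lt i.2]

theorem not_containsCopy_blockGraph {n N : ℕ} {F : SimpleGraph (Fin N)} (hm : 0 < m) (hN : m < N)
    (hF : ∃ i, ∀ k, F.Reachable i k) : ¬ ContainsCopy F (blockGraph n m) := by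
  rintro ⟨f, hf, hadj⟩
  obtain ⟨i, hi⟩ := hF
  have hwalk : ∀ a b, F.Walk a b → (f a : ℕ) / m = (f b : ℕ) / m := by
    intro a b w
    induction w with
    | nil => rfl
    | cons h _ ih => exact (hadj _ _ h).2.trans ih
  have hle : #(univ.image f) ≤ #(block n m ((f i : ℕ) / m)) := card_le_card fun x hx => by
    obtain ⟨k, -, rfl⟩ := mem_image.1 hx
    obtain ⟨w⟩ := hi k
    exact mem_block.2 (hwalk _ _ w).symm
  rw [card_image_of_injective _ hf, card_univ, Fintype.card_fin] at hle
  have := card_block_le n ((f i : ℕ) / m) hm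
  omega

theorem famSat3_blockGraph (hr : 1 ≤ r) (hrm : r < m) :
    FamSat3 (dumbbell m) (VgraphGen m r) (lambdaGraphGen m r) (blockGraph (j * m) m) := by
  have hm : 0 < m := by omega
  have hreach : ∀ {N : ℕ} {F : SimpleGraph (Fin N)} {a b : Fin N},
      (a ≠ b → F.Adj a b) → F.Reachable a b := by
    intro N F a b h
    by_cases hab : a = b
    · exact hab ▸ .rfl
    · exact (h hab).reachable
  refine ⟨?_, ?_, ?_, fun u v huv hadj => Or.inl ?_⟩
  · refine not_containsCopy_blockGraph hm (by omega) ⟨⟨0, by omega⟩, fun k => ?_⟩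
    rcases lt_or_ge (k : ℕ) m with hk | hk
    · exact hreach fun hne => (SimpleGraph.fromRel_adj _ _ _).2 ⟨hne, Or.inl (Or.inl ⟨hm, hk⟩)⟩
    · refine Reachable.trans (v := ⟨m, by omega⟩) (hreach fun hne => ?_) (hreach fun hne => ?_)
      · exact (SimpleGraph.fromRel_adj _ _ _).2 ⟨hne, Or.inl (Or.inr (Or.inr ⟨rfl, rfl⟩))⟩
      · exact (SimpleGraph.fromRel_adj _ _ _).2 ⟨hne, Or.inl (Or.inr (Or.inl ⟨le_rfl, hk⟩))⟩
  · refine not_containsCopy_blockGraph hm (by omega) ⟨⟨0, by omega⟩, fun k => ?_⟩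
    refine hreach fun hne => (SimpleGraph.fromRel_adj _ _ _).2 ⟨hne, Or.inl ?_⟩
    rcases lt_or_ge (k : ℕ) m with hk | hk
    · exact Or.inl ⟨hm, hk⟩
    · exact Or.inr ⟨Or.inl rfl, Or.inr hk⟩
  · refine not_containsCopy_blockGraph hm (by omega) ⟨⟨0, by omega⟩, fun k => ?_⟩
    refine hreach fun hne => (SimpleGraph.fromRel_adj _ _ _).2 ⟨hne, ?_⟩
    rcases lt_or_ge (k : ℕ) m with hk | hk
    · exact Or.inl (Or.inl ⟨hm, hk⟩)
    · exact Or.inr (Or.inr ⟨by omega, hr⟩)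
  · have hle : blockGraph (j * m) m ≤ addEdge (blockGraph (j * m) m) u v := le_sup_left
    have hlt : ∀ a : Fin (j * m), (a : ℕ) / m < j := fun a =>
      Nat.div_lt_of_lt_mul (mul_comm j m ▸ a.2)
    refine containsCopy_dumbbell ((isNClique_block hm (hlt u)).mono hle)
      ((isNClique_block hm (hlt v)).mono hle) ?_ (mem_block.2 rfl) (mem_block.2 rfl)
      ((addEdge_adj _ u v u v).2 (Or.inr ⟨Or.inl ⟨rfl, rfl⟩, huv⟩))
    refine disjoint_left.2 fun a ha hb => hadj ⟨huv, ?_⟩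
    rw [← mem_block.1 ha, ← mem_block.1 hb]

theorem cliqueCount_blockGraph_le (hr : 1 ≤ r) (hm : 0 < m) :
    cliqueCount (blockGraph (j * m) m) r ≤ j * m.choose r := by
  classical
  rw [cliqueCount_eq_card]
  calc #((blockGraph (j * m) m).cliqueFinset r)
      ≤ #((range j).biUnion fun q => powersetCard r (block (j * m) m q)) := by
        refine card_le_card fun t ht => ?_
        have ht := mem_cliqueFinset_iff.1 ht
        obtain ⟨a, ha⟩ := card_pos.1 (show 0 < #t by rw [ht.card_eq]; omega)
        refine mem_biUnion.2 ⟨(a : ℕ) / m, mem_range.2 (Nat.div_lt_of_lt_mul (mul_comm j m ▸ a.2)),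
          mem_powersetCard.2 ⟨fun b hb => mem_block.2 ?_, ht.card_eq⟩⟩
        by_cases hab : b = a
        · rw [hab]
        · exact (ht.isClique hb ha hab).2
    _ ≤ #(range j) * m.choose r := card_biUnion_le_card_mul _ _ _ fun q _ => by
        rw [card_powersetCard]
        exact Nat.choose_le_choose _ (card_block_le _ _ hm)
    _ = _ := by rw [card_range]

end BlockGraph

theorem satCliquesFam3_mul_le {m r : ℕ} (j : ℕ) (hr : 1 ≤ r) (hrm : r < m) :
    satCliquesFam3 (j * m) r (dumbbell m) (VgraphGen m r) (lambdaGraphGen m r) ≤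
      j * m.choose r := by
  refine le_trans (Nat.sInf_le ?_) (cliqueCount_blockGraph_le hr (by omega))
  exact ⟨_, famSat3_blockGraph hr hrm, rfl⟩

theorem exists_le_satCliquesFam3_mul_add_one {m r : ℕ} (hr : 3 ≤ r) (hm : 2 * r ^ 2 ≤ m) :
    ∃ K : ℕ, ∀ j : ℕ, 6 * m.choose r * (m.choose r + 1) * (j * m + 1) ≤
      (6 * m.choose r + 5) * m *
        satCliquesFam3 (j * m + 1) r (dumbbell m) (VgraphGen m r) (lambdaGraphGen m r) + K := by
  classical
  have hm2 : 2 * r ≤ m := by nlinarith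
  refine ⟨6 * m.choose r * (m.choose r + 1) * (r * (2 * r * (m - 1).choose (r - 1) * r + 1)),
    fun j => ?_⟩
  obtain ⟨G, hG, hcount⟩ := exists_satCliquesFam3_eq (m := m) (r := r) (j * m + 1) (by omega)
    (by omega)
  rw [← hcount, cliqueCount_eq_card]
  have hcard := hG.card_vertices (by omega)
  rw [Fintype.card_fin] at hcard
  have hne : (uncoveredVertices G m).Nonempty := by
    rw [nonempty_iff_ne_empty]
    intro h
    rw [h, card_empty, add_zero] at hcard
    have h1 : m ∣ j * m + 1 := hcard ▸ Dvd.intro_left _ rfl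
    have h2 := (Nat.dvd_add_right (Dvd.intro_left j rfl)).1 h1
    have := Nat.le_of_dvd one_pos h2
    omega
  simpa using hG.lower_bound hr hm hne

/-- For every `r ≥ 3` and `m ≥ 2r² + 2r`, with
`ℱ_m = {B_{m,m}, V_{m,r}, Λ_{m,r}}`, the sequence `sat(n, K_r, ℱ_m)/n` does not converge. -/
theorem satCliquesFam3_not_converge (r m : ℕ) (hr : 3 ≤ r) (hm : 2 * r ^ 2 + 2 * r ≤ m) :
    ¬ ∃ L : ℝ, Filter.Tendsto
      (fun n : ℕ =>
        (satCliquesFam3 n r (dumbbell m) (VgraphGen m r) (lambdaGraphGen m r) : ℝ) / (n : ℝ))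
      Filter.atTop (nhds L) := by
  rintro ⟨L, hL⟩
  have hrm : r < m := by nlinarith
  have hm0 : 0 < m := by omega
  have hm0' : (0 : ℝ) < m := by exact_mod_cast hm0
  have hM : (0 : ℝ) < m.choose r := by exact_mod_cast Nat.choose_pos hrm.le
  have hmul : Filter.Tendsto (fun j : ℕ => j * m) Filter.atTop Filter.atTop :=
    Filter.tendsto_atTop_mono (fun j => Nat.le_mul_of_pos_right j hm0) Filter.tendsto_id
  have hadd : Filter.Tendsto (fun j : ℕ => j * m + 1) Filter.atTop Filter.atTop :=
    Filter.tendsto_atTop_mono (fun j => Nat.le_succ _) hmul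
  have hupper : L ≤ m.choose r / m := by
    refine le_of_tendsto' (hL.comp hmul) fun j => ?_
    have h : (satCliquesFam3 (j * m) r (dumbbell m) (VgraphGen m r) (lambdaGraphGen m r) : ℝ) ≤
        j * m.choose r := by
      exact_mod_cast satCliquesFam3_mul_le j (by omega) hrm
    simp only [Function.comp_apply]
    rcases Nat.eq_zero_or_pos j with rfl | hj
    · simp
      positivity
    · have hj' : (0 : ℝ) < j := by exact_mod_cast hj
      rw [div_le_div_iff₀ (by positivity) hm0']
      push_cast
      nlinarith
  obtain ⟨K, hK⟩ := exists_le_satCliquesFam3_mul_add_one hr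
    (show 2 * r ^ 2 ≤ m by omega)
  have hlim : Filter.Tendsto (fun j : ℕ => (6 * m.choose r + 5) * m *
      ((satCliquesFam3 (j * m + 1) r (dumbbell m) (VgraphGen m r) (lambdaGraphGen m r) : ℝ) /
        ((j * m + 1 : ℕ) : ℝ)) + (K : ℝ) / ((j * m + 1 : ℕ) : ℝ)) Filter.atTop
      (nhds ((6 * m.choose r + 5) * m * L + 0)) :=
    ((hL.comp hadd).const_mul _).add ((tendsto_const_div_atTop_nhds_zero_nat (K : ℝ)).comp hadd)
  have hlower : 6 * (m.choose r : ℝ) * (m.choose r + 1) ≤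
      (6 * m.choose r + 5) * m * L + 0 := by
    refine ge_of_tendsto' hlim fun j => ?_
    have hpos : (0 : ℝ) < ((j * m + 1 : ℕ) : ℝ) := by positivity
    rw [← mul_div_assoc, ← add_div, le_div_iff₀ hpos]
    exact_mod_cast hK j
  have hLm : m * L ≤ m.choose r := by
    rw [le_div_iff₀ hm0'] at hupper
    linarith
  nlinarith
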